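/- There exists a constant C > 0 such that the exotic Riesz transform kernel of order ν = 1/2 satisfies, for all x, y > 0 with x ≠ y: if x/2 < y < 2x then | R̃_{1/2}(x,y) − (1/π) (xy)^{−1}/(y−x) | ≤ C y^{−3} ( 1 + log( xy/(y−x)² ) ); if 0 < y ≤ x/2 then | R̃_{1/2}(x,y) | ≤ C x^{−2} y^{−1} log(x/y); and if y ≥ 2x then | R̃_{1/2}(x,y) | ≤ C y^{−3}. -/

import Mathlib

open MeasureTheory Set ENNReal
open scoped NNReal

noncomputable section

/-- The classical Bessel heat kernel of order `-1/2`: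
`W_t^{-1/2}(x,y) = (4πt)^{-1/2} ( e^{-(x-y)²/(4t)} + e^{-(x+y)²/(4t)} )`. -/
def Wm (t x y : ℝ) : ℝ :=
  (4 * Real.pi * t) ^ (-(1/2) : ℝ) *
    (Real.exp (-(x - y) ^ 2 / (4 * t)) + Real.exp (-(x + y) ^ 2 / (4 * t)))

/-- Its boundary value `W_t^{-1/2}(0,y) = 2 (4πt)^{-1/2} e^{-y²/(4t)}`. -/
def Wm0 (t y : ℝ) : ℝ :=
  2 * (4 * Real.pi * t) ^ (-(1/2) : ℝ) * Real.exp (-y ^ 2 / (4 * t))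

/-- The exotic Riesz transform kernel of order `ν = 1/2`:
`R̃_{1/2}(x,y) = (xy)^{-1} π^{-1/2}
  ∫₀^∞ ( ∂ₓ W_t^{-1/2}(x,y) - x⁻¹ W_t^{-1/2}(x,y) + x⁻¹ W_t^{-1/2}(0,y) ) t^{-1/2} dt`. -/
def RieszHalf (x y : ℝ) : ℝ :=
  (x * y)⁻¹ * Real.pi ^ (-(1/2) : ℝ) *
    ∫ t in Ioi (0:ℝ),
      (deriv (fun u => Wm t u y) x - x⁻¹ * Wm t x y + x⁻¹ * Wm0 t y) * t ^ (-(1/2) : ℝ)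

theorem integrableOn_inv_sq_mul_exp_neg_div {c : ℝ} (hc : 0 < c) :
    IntegrableOn (fun t : ℝ => (t ^ 2)⁻¹ * Real.exp (-c / t)) (Ioi 0) := by
  have h := (integrableOn_Ioi_comp_rpow_iff' (fun s : ℝ => Real.exp (-c * s))
    (p := -1) (by norm_num)).2 (integrableOn_exp_mul_Ioi (neg_neg_of_pos hc) 0)
  refine h.congr_fun (fun t ht => ?_) measurableSet_Ioi
  have ht : 0 < t := ht
  have e : (-1 - 1 : ℝ) = -((2 : ℕ) : ℝ) := by norm_num
  simp only [smul_eq_mul]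
  rw [e, Real.rpow_neg ht.le, Real.rpow_natCast, Real.rpow_neg_one, ← div_eq_mul_inv]

theorem integral_inv_sq_mul_exp_neg_div {c : ℝ} (hc : 0 < c) :
    ∫ t in Ioi (0 : ℝ), (t ^ 2)⁻¹ * Real.exp (-c / t) = c⁻¹ := by
  have h := integral_comp_rpow_Ioi (fun s : ℝ => Real.exp (-c * s)) (p := -1) (by norm_num)
  rw [integral_exp_mul_Ioi (neg_neg_of_pos hc)] at h
  have h2 : -Real.exp (-c * 0) / -c = c⁻¹ := by
    rw [mul_zero, Real.exp_zero, neg_div_neg_eq, one_div]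
  rw [← h2, ← h]
  refine setIntegral_congr_fun measurableSet_Ioi (fun t ht => ?_)
  have ht : 0 < t := ht
  have e : (-1 - 1 : ℝ) = -((2 : ℕ) : ℝ) := by norm_num
  simp only [smul_eq_mul]
  rw [e, Real.rpow_neg ht.le, Real.rpow_natCast, Real.rpow_neg_one, abs_neg, abs_one,
    one_mul, ← div_eq_mul_inv]

theorem exp_neg_sub_exp_neg_le (p q : ℝ) :
    Real.exp (-p) - Real.exp (-q) ≤ |p - q| * Real.exp (-p) := by
  have h1 : Real.exp (-q) = Real.exp (-p) * Real.exp (p - q) := by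
    rw [← Real.exp_add]; ring_nf
  have h2 := Real.add_one_le_exp (p - q)
  have h3 := neg_abs_le (p - q)
  rw [h1]
  nlinarith [Real.exp_pos (-p)]

theorem integrableOn_inv_mul_exp_neg_div_sub {a b : ℝ} (ha : 0 < a) (hb : 0 < b) :
    IntegrableOn (fun t : ℝ => t⁻¹ * (Real.exp (-a / t) - Real.exp (-b / t))) (Ioi 0) := by
  refine Integrable.mono' (((integrableOn_inv_sq_mul_exp_neg_div ha).add
    (integrableOn_inv_sq_mul_exp_neg_div hb)).const_mul |a - b|)
    (by fun_prop) ?_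
  filter_upwards [ae_restrict_mem measurableSet_Ioi] with t ht
  have ht : 0 < t := ht
  have key : ∀ p q : ℝ, Real.exp (-p / t) - Real.exp (-q / t) ≤
      |p - q| * t⁻¹ * Real.exp (-p / t) := fun p q => by
    have := exp_neg_sub_exp_neg_le (p / t) (q / t)
    rwa [← sub_div, abs_div, abs_of_pos ht, ← neg_div, ← neg_div, div_eq_mul_inv |p - q|] at this
  have h1 := key a b
  have h2 := key b a
  rw [abs_sub_comm b a] at h2
  have h3 : 0 ≤ |a - b| * t⁻¹ := by positivity
  have h4 : |Real.exp (-a / t) - Real.exp (-b / t)| ≤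
      |a - b| * t⁻¹ * (Real.exp (-a / t) + Real.exp (-b / t)) := by
    rw [abs_le]
    constructor <;> nlinarith [mul_nonneg h3 (Real.exp_pos (-a / t)).le,
      mul_nonneg h3 (Real.exp_pos (-b / t)).le]
  rw [Real.norm_eq_abs, abs_mul, abs_of_pos (inv_pos.2 ht)]
  refine (mul_le_mul_of_nonneg_left h4 (inv_pos.2 ht).le).trans_eq ?_
  simp only [Pi.add_apply]
  field_simp

theorem integral_inv_mul_exp_neg_div_sub {a b : ℝ} (ha : 0 < a) (hb : 0 < b) :
    ∫ t in Ioi (0 : ℝ), t⁻¹ * (Real.exp (-a / t) - Real.exp (-b / t)) = Real.log (b / a) := by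
  have e : ∀ c t : ℝ, Real.exp (-(c⁻¹ * t)⁻¹) = Real.exp (-c / t) := fun c t => by
    rw [mul_inv, inv_inv, ← neg_mul, div_eq_mul_inv]
  have hcont : ContinuousOn (fun t : ℝ => Real.exp (-t⁻¹)) (Ioi 0) := fun t ht =>
    ((continuousAt_inv₀ (ne_of_gt ht)).neg.rexp).continuousWithinAt
  have h := Frullani.integral_Ioi_eq (f := fun t : ℝ => Real.exp (-t⁻¹)) (a := a⁻¹) (b := b⁻¹)
    (L := 0) (R := 1) (hcont.locallyIntegrableOn measurableSet_Ioi) (inv_pos.2 ha) (inv_pos.2 hb)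
    (Real.tendsto_exp_atBot.comp
      (Filter.tendsto_neg_atTop_atBot.comp tendsto_inv_nhdsGT_zero))
    (by
      have := (Real.continuous_exp.tendsto _).comp (tendsto_inv_atTop_zero (𝕜 := ℝ)).neg
      simpa [Function.comp_def] using this)
    (by simpa only [e, smul_eq_mul] using integrableOn_inv_mul_exp_neg_div_sub ha hb)
  simp only [e, smul_eq_mul] at h
  rw [h, zero_sub, mul_neg_one, ← Real.log_inv, inv_div, inv_div_inv]

theorem hasDerivAt_Wm (t x y : ℝ) :
    HasDerivAt (fun u => Wm t u y)
      ((4 * Real.pi * t) ^ (-(1 / 2) : ℝ) *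
        (Real.exp (-(x - y) ^ 2 / (4 * t)) * (-(2 * (x - y)) / (4 * t)) +
          Real.exp (-(x + y) ^ 2 / (4 * t)) * (-(2 * (x + y)) / (4 * t)))) x := by
  have h1 : HasDerivAt (fun u : ℝ => -(u - y) ^ 2 / (4 * t)) (-(2 * (x - y)) / (4 * t)) x := by
    simpa using ((((hasDerivAt_id x).sub_const y).pow 2).neg).div_const (4 * t)
  have h2 : HasDerivAt (fun u : ℝ => -(u + y) ^ 2 / (4 * t)) (-(2 * (x + y)) / (4 * t)) x := by
    simpa using ((((hasDerivAt_id x).add_const y).pow 2).neg).div_const (4 * t)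
  exact (h1.exp.add h2.exp).const_mul _

theorem RieszHalf_eq {x y : ℝ} (hx : 0 < x) (hy : 0 < y) (hxy : x ≠ y) :
    RieszHalf x y = (x * y)⁻¹ * (2 * Real.pi)⁻¹ *
      (2 / (y - x) - 2 / (x + y) -
        x⁻¹ * (Real.log (y ^ 2 / (x - y) ^ 2) + Real.log (y ^ 2 / (x + y) ^ 2))) := by
  have hxy' : x - y ≠ 0 := sub_ne_zero.2 hxy
  have hyx : y - x ≠ 0 := sub_ne_zero.2 hxy.symm
  have hA : 0 < (x - y) ^ 2 / 4 := by positivity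
  have hB : 0 < (x + y) ^ 2 / 4 := by positivity
  have hD : 0 < y ^ 2 / 4 := by positivity
  have hint : ∀ t ∈ Ioi (0 : ℝ),
      (deriv (fun u => Wm t u y) x - x⁻¹ * Wm t x y + x⁻¹ * Wm0 t y) * t ^ (-(1/2) : ℝ) =
      (4 * Real.pi) ^ (-(1/2) : ℝ) *
        ((-(x - y) / 2 * ((t ^ 2)⁻¹ * Real.exp (-((x - y) ^ 2 / 4) / t)) +
          -(x + y) / 2 * ((t ^ 2)⁻¹ * Real.exp (-((x + y) ^ 2 / 4) / t))) -
        x⁻¹ * (t⁻¹ * (Real.exp (-((x - y) ^ 2 / 4) / t) - Real.exp (-(y ^ 2 / 4) / t)) +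
          t⁻¹ * (Real.exp (-((x + y) ^ 2 / 4) / t) - Real.exp (-(y ^ 2 / 4) / t)))) := by
    intro t ht
    have ht : 0 < t := ht
    have e : ∀ z : ℝ, -z ^ 2 / (4 * t) = -(z ^ 2 / 4) / t := fun z => by
      rw [← neg_div, div_div]
    rw [(hasDerivAt_Wm t x y).deriv, Wm, Wm0, e, e, e, Real.mul_rpow (by positivity) ht.le]
    have ht2 : t ^ (-(1/2) : ℝ) * t ^ (-(1/2) : ℝ) = t⁻¹ := by
      rw [← Real.rpow_add ht, ← Real.rpow_neg_one]; norm_num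
    generalize t ^ (-(1/2) : ℝ) = r at *
    generalize (4 * Real.pi) ^ (-(1/2) : ℝ) = k
    generalize Real.exp (-((x - y) ^ 2 / 4) / t) = p
    generalize Real.exp (-((x + y) ^ 2 / 4) / t) = q
    generalize Real.exp (-(y ^ 2 / 4) / t) = s
    have e1 : -(2 * (x - y)) / (4 * t) = -(x - y) / 2 * t⁻¹ := by field_simp; norm_num
    have e2 : -(2 * (x + y)) / (4 * t) = -(x + y) / 2 * t⁻¹ := by field_simp; norm_num
    rw [e1, e2, ← inv_pow, ← ht2]
    ring
  have i1 := (integrableOn_inv_sq_mul_exp_neg_div hA).const_mul (-(x - y) / 2)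
  have i2 := (integrableOn_inv_sq_mul_exp_neg_div hB).const_mul (-(x + y) / 2)
  have i3 := integrableOn_inv_mul_exp_neg_div_sub hA hD
  have i4 := integrableOn_inv_mul_exp_neg_div_sub hB hD
  have hpi : Real.pi ^ (-(1/2) : ℝ) * (4 * Real.pi) ^ (-(1/2) : ℝ) = (2 * Real.pi)⁻¹ := by
    rw [← Real.mul_rpow Real.pi_pos.le (by positivity),
      show Real.pi * (4 * Real.pi) = (2 * Real.pi) ^ (2 : ℝ) by rw [Real.rpow_two]; ring,
      ← Real.rpow_mul (by positivity), ← Real.rpow_neg_one]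
    norm_num
  rw [RieszHalf, setIntegral_congr_fun measurableSet_Ioi hint, integral_const_mul,
    integral_sub (i1.fun_add i2) ((i3.fun_add i4).const_mul x⁻¹), integral_add i1 i2,
    integral_const_mul, integral_const_mul, integral_const_mul, integral_add i3 i4,
    integral_inv_sq_mul_exp_neg_div hA, integral_inv_sq_mul_exp_neg_div hB,
    integral_inv_mul_exp_neg_div_sub hA hD, integral_inv_mul_exp_neg_div_sub hB hD,
    div_div_div_cancel_right₀ (by norm_num), div_div_div_cancel_right₀ (by norm_num), ← hpi]
  have e1 : -(x - y) / 2 * ((x - y) ^ 2 / 4)⁻¹ = 2 / (y - x) := by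
    rw [← neg_sub x y]; field_simp; norm_num
  have e2 : -(x + y) / 2 * ((x + y) ^ 2 / 4)⁻¹ = -(2 / (x + y)) := by
    field_simp; norm_num
  rw [e1, e2]
  ring

theorem abs_RieszHalf_sub_le {x y : ℝ} (hx : 0 < x) (hy : 0 < y) (hxy : x ≠ y)
    (h1 : x / 2 < y) (h2 : y < 2 * x) :
    |RieszHalf x y - (1 / Real.pi) * (x * y)⁻¹ / (y - x)| ≤
      28 * (y ^ 3)⁻¹ * (1 + Real.log (x * y / (y - x) ^ 2)) := by
  have hyx : y - x ≠ 0 := sub_ne_zero.2 hxy.symm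
  have hT : 0 ≤ Real.log (x * y / (y - x) ^ 2) := by
    apply Real.log_nonneg
    rw [one_le_div (by positivity)]
    nlinarith [mul_pos (sub_pos.2 h1) (sub_pos.2 h2)]
  have e1 : Real.log (y ^ 2 / (x - y) ^ 2) =
      Real.log (x * y / (y - x) ^ 2) + Real.log (y / x) := by
    rw [← Real.log_mul (by positivity) (by positivity)]
    congr 1
    rw [← neg_sub y x, neg_sq]
    field_simp
  have e2 : Real.log (y ^ 2 / (x + y) ^ 2) = -(2 * Real.log ((x + y) / y)) := by
    rw [← div_pow, Real.log_pow, ← inv_div, Real.log_inv]; push_cast; ring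
  have b1 : Real.log (y / x) ≤ 1 :=
    (Real.log_le_sub_one_of_pos (by positivity)).trans (by
      rw [sub_le_iff_le_add, div_le_iff₀ hx]; linarith)
  have b2 : -1 ≤ Real.log (y / x) := by
    rw [← inv_div, Real.log_inv, neg_le_neg_iff]
    exact (Real.log_le_sub_one_of_pos (by positivity)).trans (by
      rw [sub_le_iff_le_add, div_le_iff₀ hy]; linarith)
  have b3 : Real.log ((x + y) / y) ≤ 2 :=
    (Real.log_le_sub_one_of_pos (by positivity)).trans (by
      rw [sub_le_iff_le_add, div_le_iff₀ hy]; linarith)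
  have b4 : 0 ≤ Real.log ((x + y) / y) :=
    Real.log_nonneg (by rw [one_le_div hy]; linarith)
  have e3 : RieszHalf x y - (1 / Real.pi) * (x * y)⁻¹ / (y - x) =
      (x * y)⁻¹ * (2 * Real.pi)⁻¹ * x⁻¹ * (-(2 * x / (x + y)) -
        (Real.log (x * y / (y - x) ^ 2) + Real.log (y / x) - 2 * Real.log ((x + y) / y))) := by
    rw [RieszHalf_eq hx hy hxy, e1, e2]
    have := Real.pi_pos
    field_simp
    ring
  have b5 : 2 * x / (x + y) ≤ 2 := by rw [div_le_iff₀ (by positivity)]; linarith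
  have b6 : 0 ≤ 2 * x / (x + y) := by positivity
  have hpi : (2 * Real.pi)⁻¹ ≤ 1 := inv_le_one_of_one_le₀ (by linarith [Real.pi_gt_three])
  have b7 : (x * y)⁻¹ * (2 * Real.pi)⁻¹ * x⁻¹ ≤ 4 * (y ^ 3)⁻¹ := by
    calc (x * y)⁻¹ * (2 * Real.pi)⁻¹ * x⁻¹ ≤ (x * y)⁻¹ * 1 * x⁻¹ := by gcongr
      _ = 1 / (x ^ 2 * y) := by field_simp
      _ ≤ 4 / y ^ 3 := by
        rw [div_le_div_iff₀ (by positivity) (by positivity)]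
        nlinarith [mul_pos hy (mul_pos (sub_pos.2 h2) (by positivity : 0 < 2 * x + y))]
      _ = 4 * (y ^ 3)⁻¹ := div_eq_mul_inv _ _
  rw [e3, abs_mul, abs_of_pos (by have := Real.pi_pos; positivity)]
  calc _ ≤ 4 * (y ^ 3)⁻¹ * (7 * (1 + Real.log (x * y / (y - x) ^ 2))) := by
        gcongr
        rw [abs_le]
        constructor <;> linarith
    _ = _ := by ring

theorem abs_RieszHalf_le_of_le_half {x y : ℝ} (hx : 0 < x) (hy : 0 < y) (h : y ≤ x / 2) :
    |RieszHalf x y| ≤ 28 * (x ^ 2)⁻¹ * y⁻¹ * Real.log (x / y) := by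
  have hxy : 0 < x - y := by linarith
  have e1 : Real.log (y ^ 2 / (x - y) ^ 2) = -(2 * Real.log ((x - y) / y)) := by
    rw [← div_pow, Real.log_pow, ← inv_div, Real.log_inv]; push_cast; ring
  have e2 : Real.log (y ^ 2 / (x + y) ^ 2) = -(2 * Real.log ((x + y) / y)) := by
    rw [← div_pow, Real.log_pow, ← inv_div, Real.log_inv]; push_cast; ring
  have hT : 1 / 2 ≤ Real.log (x / y) := by
    have : Real.log 2 ≤ Real.log (x / y) :=
      Real.log_le_log (by norm_num) (by rw [le_div_iff₀ hy]; linarith)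
    linarith [Real.log_two_gt_d9]
  have b1 : 0 ≤ Real.log ((x - y) / y) := Real.log_nonneg (by rw [one_le_div hy]; linarith)
  have b2 : Real.log ((x - y) / y) ≤ Real.log (x / y) :=
    Real.log_le_log (by positivity) (by gcongr; linarith)
  have b3 : 0 ≤ Real.log ((x + y) / y) := Real.log_nonneg (by rw [one_le_div hy]; linarith)
  have b4 : Real.log ((x + y) / y) ≤ 2 * Real.log (x / y) := by
    have : Real.log (x / y) * 2 = Real.log ((x / y) ^ 2) := by
      rw [Real.log_pow]; push_cast; ring
    rw [mul_comm, this]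
    refine Real.log_le_log (by positivity) ?_
    rw [div_pow, div_le_div_iff₀ (by positivity) (by positivity)]
    nlinarith [mul_pos hx hy]
  have b5 : 2 * x / (x - y) ≤ 4 := by rw [div_le_iff₀ hxy]; linarith
  have b6 : 2 * x / (x + y) ≤ 2 := by rw [div_le_iff₀ (by positivity)]; linarith
  have b7 : 0 ≤ 2 * x / (x - y) := by positivity
  have b8 : 0 ≤ 2 * x / (x + y) := by positivity
  have hpi : (2 * Real.pi)⁻¹ ≤ 1 := inv_le_one_of_one_le₀ (by linarith [Real.pi_gt_three])
  have e3 : RieszHalf x y = (x * y)⁻¹ * (2 * Real.pi)⁻¹ * x⁻¹ *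
      (-(2 * x / (x - y)) - 2 * x / (x + y) +
        (2 * Real.log ((x - y) / y) + 2 * Real.log ((x + y) / y))) := by
    rw [RieszHalf_eq hx hy (sub_pos.1 hxy).ne', e1, e2, ← neg_sub x y, div_neg]
    have := Real.pi_pos
    field_simp
    ring
  rw [e3, abs_mul, abs_of_pos (by have := Real.pi_pos; positivity)]
  calc _ ≤ (x * y)⁻¹ * 1 * x⁻¹ * (28 * Real.log (x / y)) := by
        gcongr
        rw [abs_le]
        constructor <;> linarith
    _ = _ := by field_simp

theorem abs_RieszHalf_le_of_two_mul_le {x y : ℝ} (hx : 0 < x) (hy : 0 < y) (h : 2 * x ≤ y) :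
    |RieszHalf x y| ≤ 28 * (y ^ 3)⁻¹ := by
  have hyx : 0 < y - x := by linarith
  have hd : 3 / 4 * y ^ 2 ≤ y ^ 2 - x ^ 2 := by nlinarith
  have hd0 : 0 < y ^ 2 - x ^ 2 := by nlinarith
  have e1 : Real.log (y ^ 2 / (x - y) ^ 2) + Real.log (y ^ 2 / (x + y) ^ 2) =
      2 * Real.log (y ^ 2 / (y ^ 2 - x ^ 2)) := by
    have hxy : x - y ≠ 0 := by linarith
    have : 2 * Real.log (y ^ 2 / (y ^ 2 - x ^ 2)) =
        Real.log ((y ^ 2 / (y ^ 2 - x ^ 2)) ^ 2) := by rw [Real.log_pow]; push_cast; ring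
    rw [← Real.log_mul (by positivity) (by positivity), this]
    congr 1
    rw [div_mul_div_comm, div_pow]
    congr 1 <;> ring
  have b1 : 0 ≤ Real.log (y ^ 2 / (y ^ 2 - x ^ 2)) :=
    Real.log_nonneg (by rw [one_le_div hd0]; nlinarith)
  have b2 : Real.log (y ^ 2 / (y ^ 2 - x ^ 2)) ≤ 4 / 3 * (x ^ 2 / y ^ 2) := by
    refine (Real.log_le_sub_one_of_pos (by positivity)).trans ?_
    calc y ^ 2 / (y ^ 2 - x ^ 2) - 1 = x ^ 2 / (y ^ 2 - x ^ 2) := by field_simp; ring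
      _ ≤ x ^ 2 / (3 / 4 * y ^ 2) := by gcongr
      _ = _ := by field_simp
  have b3 : 2 * x / (y - x) - 2 * x / (x + y) ≤ 16 / 3 * (x ^ 2 / y ^ 2) := by
    calc 2 * x / (y - x) - 2 * x / (x + y) = 4 * x ^ 2 / (y ^ 2 - x ^ 2) := by
          rw [show y ^ 2 - x ^ 2 = (y - x) * (x + y) by ring]; field_simp; ring
      _ ≤ 4 * x ^ 2 / (3 / 4 * y ^ 2) := by gcongr
      _ = _ := by field_simp; norm_num
  have b4 : 0 ≤ 2 * x / (y - x) - 2 * x / (x + y) :=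
    sub_nonneg.2 (by gcongr; linarith)
  have b5 : 0 ≤ x ^ 2 / y ^ 2 := by positivity
  have hpi : (2 * Real.pi)⁻¹ ≤ 1 := inv_le_one_of_one_le₀ (by linarith [Real.pi_gt_three])
  have e3 : RieszHalf x y = (x * y)⁻¹ * (2 * Real.pi)⁻¹ * x⁻¹ *
      (2 * x / (y - x) - 2 * x / (x + y) - 2 * Real.log (y ^ 2 / (y ^ 2 - x ^ 2))) := by
    rw [RieszHalf_eq hx hy (sub_pos.1 hyx).ne, e1]
    have := Real.pi_pos
    field_simp
  rw [e3, abs_mul, abs_of_pos (by have := Real.pi_pos; positivity)]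
  calc _ ≤ (x * y)⁻¹ * 1 * x⁻¹ * (28 * (x ^ 2 / y ^ 2)) := by
        gcongr
        rw [abs_le]
        constructor <;> linarith
    _ = _ := by field_simp

theorem stmt17 :
    ∃ C : ℝ, 0 < C ∧ ∀ x y : ℝ, 0 < x → 0 < y → x ≠ y →
      (x / 2 < y → y < 2 * x →
        |RieszHalf x y - (1 / Real.pi) * (x * y)⁻¹ / (y - x)| ≤
          C * y ^ (-3 : ℝ) * (1 + Real.log (x * y / (y - x) ^ 2))) ∧
      (y ≤ x / 2 →
        |RieszHalf x y| ≤ C * x ^ (-2 : ℝ) * y⁻¹ * Real.log (x / y)) ∧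
      (2 * x ≤ y →
        |RieszHalf x y| ≤ C * y ^ (-3 : ℝ)) := by
  have rpow_neg_nat : ∀ z : ℝ, 0 < z → z ^ (-3 : ℝ) = (z ^ 3)⁻¹ ∧ z ^ (-2 : ℝ) = (z ^ 2)⁻¹ :=
    fun z hz => ⟨by rw [Real.rpow_neg hz.le]; norm_cast, by rw [Real.rpow_neg hz.le]; norm_cast⟩
  refine ⟨28, by norm_num, fun x y hx hy hxy => ⟨fun h1 h2 => ?_, fun h => ?_, fun h => ?_⟩⟩
  · rw [(rpow_neg_nat y hy).1]
    exact abs_RieszHalf_sub_le hx hy hxy h1 h2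
  · rw [(rpow_neg_nat x hx).2]
    exact abs_RieszHalf_le_of_le_half hx hy h
  · rw [(rpow_neg_nat y hy).1]
    exact abs_RieszHalf_le_of_two_mul_le hx hy h

end
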